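/- Positive commutator identity (Lemma 8.5, radial form): let β : (0,∞) → ℝ be smooth and κ ∈ ℝ, and let Q be the associated multiplier. For every test function v, Re ∫ i ((ρ²+κ²) v + Δ_rad v) · conj( Q v − 2 β κ v ) dμ_d = ∫ β′ |v′ + (ρ coth(r) − iκ) v|² dμ_d + ρ(ρ−1) ∫ (2 β coth(r) − β′) sinh(r)^{−2} |v|² dμ_d − Re ∫ ((ρ²+κ²) v + Δ_rad v) · conj(v) · β′ dμ_d. -/

import Mathlib

open MeasureTheory Set

/-- A radial test function: a smooth function on `ℝ` with compact support
contained in `(0, ∞)`. -/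
def IsTestFun (v : ℝ → ℂ) : Prop :=
  ContDiff ℝ (⊤ : ℕ∞) v ∧ HasCompactSupport v ∧ tsupport v ⊆ Set.Ioi (0 : ℝ)

/-- The hyperbolic cotangent. -/
noncomputable def cothR (r : ℝ) : ℝ := Real.cosh r / Real.sinh r

/-- `ρ = (d-1)/2`. -/
noncomputable def rho (d : ℕ) : ℝ := ((d : ℝ) - 1) / 2

/-- The radial part of the Laplace–Beltrami operator of hyperbolic space:
`Δ_rad f = f″ + (d−1) coth(r) f′`. -/
noncomputable def DradC (d : ℕ) (v : ℝ → ℂ) (r : ℝ) : ℂ :=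
  deriv (deriv v) r + ((((d : ℝ) - 1) * cothR r : ℝ) : ℂ) * deriv v r

/-- The multiplier associated with a smooth real-valued `β` on `(0,∞)`:
`Q v = (1/i)(2 β v′ + β′ v + (d−1) coth(r) β v)`. -/
noncomputable def Qmul (d : ℕ) (β : ℝ → ℝ) (v : ℝ → ℂ) (r : ℝ) : ℂ :=
  Complex.I⁻¹ * (2 * ((β r : ℝ) : ℂ) * deriv v r + ((deriv β r : ℝ) : ℂ) * v r
    + ((((d : ℝ) - 1) * cothR r * β r : ℝ) : ℂ) * v r)

/-- A function continuous on `(0, ∞)` that vanishes outside a compact subset of `(0, ∞)` is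
integrable there. -/
lemma integrableOn_Ioi_of_continuousOn_of_eq_zero {E : Type*} [NormedAddCommGroup E]
    {f : ℝ → E} {K : Set ℝ} (hK : IsCompact K) (hK0 : K ⊆ Ioi 0) (hf : ContinuousOn f (Ioi 0))
    (h0 : ∀ x ∉ K, f x = 0) : IntegrableOn f (Ioi 0) :=
  ((hf.mono hK0).integrableOn_compact hK).of_forall_sdiff_eq_zero measurableSet_Ioi
    fun x hx => h0 x hx.2

/-- The integral over `(0, ∞)` of the derivative of a function supported in a compact subset of
`(0, ∞)` vanishes. -/
lemma integral_Ioi_deriv_eq_zero {G G' : ℝ → ℝ} {K : Set ℝ} (hK : IsCompact K)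
    (hK0 : K ⊆ Ioi 0) (hG : ∀ x ∈ Ioi (0 : ℝ), HasDerivAt G (G' x) x)
    (hG' : IntegrableOn G' (Ioi 0)) (h0 : ∀ x ∉ K, G x = 0) :
    ∫ x in Ioi (0 : ℝ), G' x = 0 := by
  have h0K : (0 : ℝ) ∉ K := fun h => lt_irrefl (0 : ℝ) (hK0 h)
  have hcont : ContinuousWithinAt G (Ici 0) 0 := by
    have hev : G =ᶠ[nhds 0] fun _ => 0 := by
      filter_upwards [hK.isClosed.isOpen_compl.mem_nhds h0K] with x hx using h0 x hx
    exact (continuousAt_const.congr hev.symm).continuousWithinAt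
  have htop : Filter.Tendsto G Filter.atTop (nhds 0) := by
    obtain ⟨b, hb⟩ := hK.bddAbove
    refine tendsto_const_nhds.congr' ?_
    filter_upwards [Filter.eventually_gt_atTop b] with x hx
    exact (h0 x fun h => absurd (hb h) (not_le.2 hx)).symm
  rw [integral_Ioi_of_hasDerivAt_of_tendsto hcont hG hG' htop, h0 0 h0K, sub_zero]

lemma cothR_sq {r : ℝ} (hr : 0 < r) : cothR r ^ 2 = 1 + (Real.sinh r ^ 2)⁻¹ := by
  have hS : Real.sinh r ≠ 0 := (Real.sinh_pos_iff.2 hr).ne'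
  rw [cothR, div_pow, Real.cosh_sq]
  field_simp

lemma hasDerivAt_cothR {r : ℝ} (hr : 0 < r) :
    HasDerivAt cothR (-(Real.sinh r ^ 2)⁻¹) r := by
  have hS : Real.sinh r ≠ 0 := (Real.sinh_pos_iff.2 hr).ne'
  refine ((Real.hasDerivAt_cosh r).div (Real.hasDerivAt_sinh r) hS).congr_deriv ?_
  field_simp
  linarith [Real.cosh_sq r]

lemma hasDerivAt_inv_sinh_sq {r : ℝ} (hr : 0 < r) :
    HasDerivAt (fun x => (Real.sinh x ^ 2)⁻¹) (-2 * cothR r * (Real.sinh r ^ 2)⁻¹) r := by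
  have hS : Real.sinh r ≠ 0 := (Real.sinh_pos_iff.2 hr).ne'
  refine (((Real.hasDerivAt_sinh r).pow 2).inv (pow_ne_zero 2 hS)).congr_deriv ?_
  simp only [Pi.pow_apply, cothR]
  field_simp
  norm_num
  ring

lemma hasDerivAt_sinh_pow (n : ℕ) {r : ℝ} (hr : 0 < r) :
    HasDerivAt (fun x => Real.sinh x ^ n) (n * cothR r * Real.sinh r ^ n) r := by
  have hS : Real.sinh r ≠ 0 := (Real.sinh_pos_iff.2 hr).ne'
  refine ((Real.hasDerivAt_sinh r).pow n).congr_deriv ?_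
  rcases n with _ | n
  · simp
  · simp only [cothR, Nat.add_sub_cancel, pow_succ]
    field_simp

lemma HasDerivAt.complex_re {f : ℝ → ℂ} {f' : ℂ} {x : ℝ} (h : HasDerivAt f f' x) :
    HasDerivAt (fun y => (f y).re) f'.re x :=
  Complex.reCLM.hasFDerivAt.comp_hasDerivAt x h

lemma HasDerivAt.complex_im {f : ℝ → ℂ} {f' : ℂ} {x : ℝ} (h : HasDerivAt f f' x) :
    HasDerivAt (fun y => (f y).im) f'.im x :=
  Complex.imCLM.hasFDerivAt.comp_hasDerivAt x h

/-- **Positive commutator identity** (Lemma 8.5, radial form). -/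
theorem positive_commutator_identity (d : ℕ) (hd : 2 ≤ d)
    (β : ℝ → ℝ) (hβ : ContDiffOn ℝ (⊤ : ℕ∞) β (Ioi (0 : ℝ))) (κ : ℝ)
    (v : ℝ → ℂ) (hv : IsTestFun v) :
    (∫ r in Ioi (0 : ℝ),
        Complex.I * (((rho d ^ 2 + κ ^ 2 : ℝ) : ℂ) * v r + DradC d v r)
          * (starRingEnd ℂ) (Qmul d β v r - 2 * ((β r * κ : ℝ) : ℂ) * v r)
          * ((Real.sinh r ^ (d - 1) : ℝ) : ℂ)).re
      = (∫ r in Ioi (0 : ℝ),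
          deriv β r
            * ‖deriv v r + (((rho d * cothR r : ℝ) : ℂ) - Complex.I * (κ : ℂ)) * v r‖ ^ 2
            * Real.sinh r ^ (d - 1))
        + rho d * (rho d - 1) * (∫ r in Ioi (0 : ℝ),
            (2 * β r * cothR r - deriv β r) * (Real.sinh r ^ 2)⁻¹ * ‖v r‖ ^ 2
              * Real.sinh r ^ (d - 1))
        - (∫ r in Ioi (0 : ℝ),
            (((rho d ^ 2 + κ ^ 2 : ℝ) : ℂ) * v r + DradC d v r) * (starRingEnd ℂ) (v r)
              * ((deriv β r * Real.sinh r ^ (d - 1) : ℝ) : ℂ)).re := by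
  obtain ⟨hsm, hK, hK0⟩ := hv
  have hsm1 : ContDiff ℝ (⊤ : ℕ∞) (deriv v) := (contDiff_infty_iff_deriv.1 hsm).2
  have hv0 : Continuous v := hsm.continuous
  have hv1 : Continuous (deriv v) := hsm1.continuous
  have hv2 : Continuous (deriv (deriv v)) := (contDiff_infty_iff_deriv.1 hsm1).2.continuous
  have hβ0 : ContinuousOn β (Ioi 0) := hβ.continuousOn
  have hβ1 : ContinuousOn (deriv β) (Ioi 0) :=
    hβ.continuousOn_deriv_of_isOpen isOpen_Ioi (by simp)
  have hβd : ∀ r ∈ Ioi (0 : ℝ), HasDerivAt β (deriv β r) r := fun r hr =>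
    ((hβ.differentiableOn (by simp)).differentiableAt (isOpen_Ioi.mem_nhds hr)).hasDerivAt
  have hc : ContinuousOn cothR (Ioi 0) := fun r hr =>
    (hasDerivAt_cothR hr).continuousAt.continuousWithinAt
  have hs : ContinuousOn (fun r => (Real.sinh r ^ 2)⁻¹) (Ioi 0) := fun r hr =>
    (hasDerivAt_inv_sinh_sq hr).continuousAt.continuousWithinAt
  have z0 : ∀ r ∉ tsupport v, v r = 0 := fun r hr => image_eq_zero_of_notMem_tsupport hr
  have z1 : ∀ r ∉ tsupport v, deriv v r = 0 := fun r hr =>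
    image_eq_zero_of_notMem_tsupport fun h => hr (tsupport_deriv_subset h)
  have z2 : ∀ r ∉ tsupport v, deriv (deriv v) r = 0 := fun r hr =>
    image_eq_zero_of_notMem_tsupport fun h =>
      hr (tsupport_deriv_subset (tsupport_deriv_subset h))
  have hdρ : ((d - 1 : ℕ) : ℝ) = 2 * rho d := by
    rw [Nat.cast_sub (by omega), rho]; push_cast; ring
  have hdρ' : (d : ℝ) - 1 = 2 * rho d := by rw [rho]; ring
  set f₁ : ℝ → ℂ := fun r =>
    Complex.I * (((rho d ^ 2 + κ ^ 2 : ℝ) : ℂ) * v r + DradC d v r)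
      * (starRingEnd ℂ) (Qmul d β v r - 2 * ((β r * κ : ℝ) : ℂ) * v r)
      * ((Real.sinh r ^ (d - 1) : ℝ) : ℂ) with hf₁
  set f₂ : ℝ → ℝ := fun r => deriv β r
    * ‖deriv v r + (((rho d * cothR r : ℝ) : ℂ) - Complex.I * (κ : ℂ)) * v r‖ ^ 2
    * Real.sinh r ^ (d - 1) with hf₂
  set f₃ : ℝ → ℝ := fun r =>
    (2 * β r * cothR r - deriv β r) * (Real.sinh r ^ 2)⁻¹ * ‖v r‖ ^ 2
      * Real.sinh r ^ (d - 1) with hf₃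
  set f₄ : ℝ → ℂ := fun r =>
    (((rho d ^ 2 + κ ^ 2 : ℝ) : ℂ) * v r + DradC d v r) * (starRingEnd ℂ) (v r)
      * ((deriv β r * Real.sinh r ^ (d - 1) : ℝ) : ℂ) with hf₄
  have i₁ : IntegrableOn f₁ (Ioi 0) := by
    refine integrableOn_Ioi_of_continuousOn_of_eq_zero hK hK0 ?_ fun r hr => ?_
    · simp only [hf₁, DradC, Qmul]
      fun_prop
    · simp [hf₁, DradC, z0 r hr, z1 r hr, z2 r hr]
  have i₂ : IntegrableOn f₂ (Ioi 0) := by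
    refine integrableOn_Ioi_of_continuousOn_of_eq_zero hK hK0 ?_ fun r hr => ?_
    · simp only [hf₂]
      fun_prop
    · simp [hf₂, z0 r hr, z1 r hr]
  have i₃ : IntegrableOn f₃ (Ioi 0) := by
    refine integrableOn_Ioi_of_continuousOn_of_eq_zero hK hK0 ?_ fun r hr => ?_
    · simp only [hf₃]
      fun_prop
    · simp [hf₃, z0 r hr]
  have i₄ : IntegrableOn f₄ (Ioi 0) := by
    refine integrableOn_Ioi_of_continuousOn_of_eq_zero hK hK0 ?_ fun r hr => ?_
    · simp only [hf₄, DradC]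
      fun_prop
    · simp [hf₄, z0 r hr]
  have j₁ : IntegrableOn (fun r => (f₁ r).re) (Ioi 0) := i₁.re
  have j₄ : IntegrableOn (fun r => (f₄ r).re) (Ioi 0) := i₄.re
  have e₁ : ∫ r in Ioi (0 : ℝ), (f₁ r).re = (∫ r in Ioi (0 : ℝ), f₁ r).re :=
    Complex.reCLM.integral_comp_comm i₁
  have e₄ : ∫ r in Ioi (0 : ℝ), (f₄ r).re = (∫ r in Ioi (0 : ℝ), f₄ r).re :=
    Complex.reCLM.integral_comp_comm i₄
  have j₃ : IntegrableOn (fun r => rho d * (rho d - 1) * f₃ r) (Ioi 0) := i₃.const_mul _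
  have j₁₂ : IntegrableOn (fun r => f₂ r - (f₁ r).re) (Ioi 0) := i₂.sub j₁
  have j₃₄ : IntegrableOn (fun r => rho d * (rho d - 1) * f₃ r - (f₄ r).re) (Ioi 0) := j₃.sub j₄
  have key : ∫ r in Ioi (0 : ℝ),
      ((f₂ r - (f₁ r).re) + (rho d * (rho d - 1) * f₃ r - (f₄ r).re)) = 0 := by
    refine integral_Ioi_deriv_eq_zero (G := fun r => Real.sinh r ^ (d - 1) * β r *
      ((((deriv v r).re + rho d * cothR r * (v r).re + κ * (v r).im) ^ 2
        + ((deriv v r).im + rho d * cothR r * (v r).im - κ * (v r).re) ^ 2)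
        - rho d * (rho d - 1) * (Real.sinh r ^ 2)⁻¹ * ((v r).re ^ 2 + (v r).im ^ 2)))
      hK hK0 (fun r hr => ?_) (j₁₂.add j₃₄) fun r hr => by simp [z0 r hr, z1 r hr]
    have hd0 : HasDerivAt v (deriv v r) r := (hsm.differentiable (by simp) r).hasDerivAt
    have hd1 : HasDerivAt (deriv v) (deriv (deriv v) r) r :=
      (hsm1.differentiable (by simp) r).hasDerivAt
    have hw := hasDerivAt_sinh_pow (d - 1) hr
    have hcd := (hasDerivAt_cothR hr).const_mul (rho d)
    have hsd := (hasDerivAt_inv_sinh_sq hr).const_mul (rho d * (rho d - 1))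
    have hre := (hd1.complex_re.add (hcd.mul hd0.complex_re)).add (hd0.complex_im.const_mul κ)
    have him := (hd1.complex_im.add (hcd.mul hd0.complex_im)).sub (hd0.complex_re.const_mul κ)
    have hnv := (hd0.complex_re.pow 2).add (hd0.complex_im.pow 2)
    refine ((hw.mul (hβd r hr)).mul
      (((hre.pow 2).add (him.pow 2)).sub (hsd.mul hnv))).congr_deriv ?_
    have hc2 := cothR_sq hr
    simp only [hf₁, hf₂, hf₃, hf₄, DradC, Qmul, hdρ, hdρ', Complex.sq_norm, Complex.normSq_apply,
      Pi.add_apply, Pi.sub_apply, Pi.mul_apply, Pi.pow_apply]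
    generalize (Real.sinh r ^ 2)⁻¹ = s at *
    generalize Real.sinh r ^ (d - 1) = w at *
    generalize cothR r = c at *
    generalize rho d = ρ at *
    generalize deriv (deriv v) r = v₂ at *
    generalize deriv v r = v₁ at *
    generalize v r = v₀ at *
    generalize deriv β r = β₁ at *
    generalize β r = β₀ at *
    obtain rfl : s = c ^ 2 - 1 := by linarith
    simp only [Complex.inv_I, pow_two, map_sub, map_add, map_mul, map_neg, Complex.conj_I,
      Complex.conj_ofReal, map_ofNat, Complex.add_re, Complex.add_im, Complex.sub_re,
      Complex.sub_im, Complex.mul_re, Complex.mul_im, Complex.neg_re, Complex.neg_im, Complex.I_re,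
      Complex.I_im, Complex.ofReal_re, Complex.ofReal_im, Complex.conj_re, Complex.conj_im,
      Complex.re_ofNat, Complex.im_ofNat]
    ring
  rw [integral_add j₁₂ j₃₄, integral_sub i₂ j₁, integral_sub j₃ j₄, integral_const_mul,
    e₁, e₄] at key
  linarith
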